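/- Let F = g + h∘c with μ = Lβ as above and t > 0. Then for every x, ‖G_t(x)‖ ≤ ((1+2tμ)/(1+tμ)) ( √(tμ/(1+tμ)) + 1 ) ‖∇F_{t/(1+tμ)}(x)‖. -/

import Mathlib

variable {E : Type*} [NormedAddCommGroup E] [InnerProductSpace ℝ E]

open scoped RealInnerProductSpace in
/-- The quadratic term in a lower bound of a convex function touching it at `z₀` can be dropped. -/
theorem ConvexOn.le_add_inner_of_le_add_sq {ψ : E → ℝ} (hψ : ConvexOn ℝ Set.univ ψ) {z₀ w : E}
    {K : ℝ} (hK : ∀ z, ψ z₀ ≤ ψ z + ⟪w, z - z₀⟫ + K * ‖z - z₀‖ ^ 2) (z : E) :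
    ψ z₀ ≤ ψ z + ⟪w, z - z₀⟫ := by
  have key : ∀ τ ∈ Set.Ioo (0 : ℝ) 1,
      ψ z₀ - (ψ z + ⟪w, z - z₀⟫) ≤ τ * (K * ‖z - z₀‖ ^ 2) := by
    rintro τ ⟨h0, h1⟩
    have hconv := hψ.2 (Set.mem_univ z₀) (Set.mem_univ z) (sub_nonneg.2 h1.le) h0.le
      (sub_add_cancel 1 τ)
    have hz : (1 - τ) • z₀ + τ • z - z₀ = τ • (z - z₀) := by module
    have := hK ((1 - τ) • z₀ + τ • z)
    rw [hz, inner_smul_right, norm_smul, mul_pow, Real.norm_of_nonneg h0.le] at this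
    simp only [smul_eq_mul] at hconv
    refine le_of_mul_le_mul_left ?_ h0
    nlinarith
  have hlim : Filter.Tendsto (fun τ : ℝ ↦ τ * (K * ‖z - z₀‖ ^ 2)) (nhdsWithin 0 (Set.Ioi 0))
      (nhds 0) := by
    have : Continuous fun τ : ℝ ↦ τ * (K * ‖z - z₀‖ ^ 2) := by fun_prop
    simpa using (this.tendsto 0).mono_left nhdsWithin_le_nhds
  have := ge_of_tendsto hlim
    (Filter.mem_of_superset (Ioo_mem_nhdsGT (zero_lt_one' ℝ)) key)
  linarith

/-- The quadratic Taylor remainder bound for a map with Lipschitz derivative. -/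
theorem norm_sub_sub_fderiv_le_of_lipschitz {E F : Type*} [NormedAddCommGroup E] [NormedSpace ℝ E]
    [NormedAddCommGroup F] [NormedSpace ℝ F] {c : E → F} {β : ℝ} (hc : Differentiable ℝ c)
    (hcβ : ∀ x y, ‖fderiv ℝ c x - fderiv ℝ c y‖ ≤ β * ‖x - y‖) (x y : E) :
    ‖c y - (c x + fderiv ℝ c x (y - x))‖ ≤ β / 2 * ‖y - x‖ ^ 2 := by
  set A := fderiv ℝ c x
  have hline : ∀ s : ℝ, HasDerivAt (fun s : ℝ ↦ x + s • (y - x)) (y - x) s := fun s ↦ by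
    simpa using ((hasDerivAt_id s).smul_const (y - x)).const_add x
  have hf : ∀ s : ℝ, HasDerivAt (fun s : ℝ ↦ c (x + s • (y - x)) - (c x + s • A (y - x)))
      (fderiv ℝ c (x + s • (y - x)) (y - x) - A (y - x)) s := fun s ↦ by
    refine ((hc _).hasFDerivAt.comp_hasDerivAt s (hline s)).sub ?_
    simpa using ((hasDerivAt_id s).smul_const (A (y - x))).const_add (c x)
  have hB : ∀ s : ℝ, HasDerivAt (fun s : ℝ ↦ β / 2 * ‖y - x‖ ^ 2 * s ^ 2)
      (β * ‖y - x‖ ^ 2 * s) s := fun s ↦ by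
    refine ((hasDerivAt_pow 2 s).const_mul (β / 2 * ‖y - x‖ ^ 2)).congr_deriv ?_
    push_cast
    ring
  have := image_norm_le_of_norm_deriv_right_le_deriv_boundary (a := 0) (b := 1)
    (HasDerivAt.continuousOn fun s _ ↦ hf s) (fun s _ ↦ (hf s).hasDerivWithinAt)
    (B := fun s : ℝ ↦ β / 2 * ‖y - x‖ ^ 2 * s ^ 2) (by simp) hB (fun s hs ↦ by
      rw [← sub_apply]
      refine (ContinuousLinearMap.le_of_opNorm_le _ (hcβ _ _) _).trans_eq ?_
      rw [add_sub_cancel_left, norm_smul, Real.norm_of_nonneg hs.1]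
      ring) (Set.right_mem_Icc.2 zero_le_one)
  simpa using this

/-- A differentiable lower envelope of translated parabolas has the gradient of the parabola
touching it. -/
theorem HasGradientAt.eq_smul_sub_of_le_parabola [CompleteSpace E] {e : E → ℝ} {x p v : E}
    {a k : ℝ} (he : HasGradientAt e v x) (hle : ∀ w, e w ≤ a + k / 2 * ‖p - w‖ ^ 2)
    (heq : e x = a + k / 2 * ‖p - x‖ ^ 2) : v = k • (x - p) := by
  have hq : HasFDerivAt (fun w ↦ a + k / 2 * ‖w - p‖ ^ 2)
      ((k / 2) • (2 • (innerSL ℝ (x - p)))) x := by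
    simpa using (((hasFDerivAt_id x).sub_const p).norm_sq.const_mul (k / 2)).const_add a
  have hmin : IsLocalMin (fun w ↦ a + k / 2 * ‖w - p‖ ^ 2 - e w) x :=
    Filter.Eventually.of_forall fun w ↦ by
      have := hle w
      rw [norm_sub_rev] at this heq
      simp only [heq, sub_self]
      linarith
  have h0 := hmin.hasFDerivAt_eq_zero (hq.sub he.hasFDerivAt)
  refine ext_inner_right ℝ fun z ↦ ?_
  have := DFunLike.congr_fun h0 z
  simp only [sub_apply, smul_apply, innerSL_apply_apply, inner_sub_left,
    InnerProductSpace.toDual_apply_apply, zero_apply, smul_eq_mul, nsmul_eq_mul, Nat.cast_ofNat] at this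
  rw [real_inner_smul_left, inner_sub_left]
  linarith

/-- The convex model of `g + h ∘ c` obtained by linearizing `c` at `y`. -/
noncomputable def linearizedModel {E F : Type*} [NormedAddCommGroup E] [NormedSpace ℝ E]
    [NormedAddCommGroup F] [NormedSpace ℝ F] (g : E → ℝ) (h : F → ℝ) (c : E → F) (y z : E) : ℝ :=
  g z + h (c y + fderiv ℝ c y (z - y))

section LinearizedModel

variable {F : Type*} [NormedAddCommGroup F] [NormedSpace ℝ F] {g : E → ℝ} {h : F → ℝ} {c : E → F}
  {L β t : ℝ}

@[simp]
theorem linearizedModel_self (y : E) : linearizedModel g h c y y = g y + h (c y) := by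
  simp [linearizedModel]

theorem convexOn_linearizedModel (hg : ConvexOn ℝ Set.univ g) (hh : ConvexOn ℝ Set.univ h)
    (y : E) : ConvexOn ℝ Set.univ (linearizedModel g h c y) := by
  refine hg.add ?_
  have := hh.comp_affineMap
    (AffineMap.const ℝ E (c y - fderiv ℝ c y y) + (fderiv ℝ c y).toLinearMap.toAffineMap)
  rw [Set.preimage_univ] at this
  refine this.congr fun z _ ↦ congrArg h ?_
  simp only [map_sub, AffineMap.coe_add, AffineMap.coe_const, Pi.add_apply,
    Function.const_apply, LinearMap.coe_toAffineMap, ContinuousLinearMap.coe_coe]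
  abel

theorem abs_sub_linearizedModel_le (hL : 0 ≤ L) (hhL : ∀ u v, |h u - h v| ≤ L * ‖u - v‖)
    (hc : Differentiable ℝ c)
    (hcβ : ∀ x y, ‖fderiv ℝ c x - fderiv ℝ c y‖ ≤ β * ‖x - y‖) (y z : E) :
    |g z + h (c z) - linearizedModel g h c y z| ≤ L * β / 2 * ‖z - y‖ ^ 2 := by
  rw [linearizedModel, add_sub_add_left_eq_sub]
  refine (hhL _ _).trans ?_
  have := mul_le_mul_of_nonneg_left (norm_sub_sub_fderiv_le_of_lipschitz hc hcβ y z) hL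
  linarith

/-- Comparison of the linearized models at two base points. -/
theorem linearizedModel_le_add (hL : 0 ≤ L) (hhL : ∀ u v, |h u - h v| ≤ L * ‖u - v‖)
    (hc : Differentiable ℝ c)
    (hcβ : ∀ x y, ‖fderiv ℝ c x - fderiv ℝ c y‖ ≤ β * ‖x - y‖) (x y z : E) :
    linearizedModel g h c y z ≤ linearizedModel g h c x z + L * β / 2 * ‖y - x‖ ^ 2 +
      L * β * (‖y - x‖ * ‖z - y‖) := by
  have hnorm : ‖c y + fderiv ℝ c y (z - y) - (c x + fderiv ℝ c x (z - x))‖ ≤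
      β / 2 * ‖y - x‖ ^ 2 + β * ‖y - x‖ * ‖z - y‖ := by
    have heq : c y + fderiv ℝ c y (z - y) - (c x + fderiv ℝ c x (z - x)) =
        c y - (c x + fderiv ℝ c x (y - x)) + (fderiv ℝ c y - fderiv ℝ c x) (z - y) := by
      simp only [sub_apply, map_sub]
      abel
    rw [heq]
    exact norm_add_le_of_le (norm_sub_sub_fderiv_le_of_lipschitz hc hcβ x y)
      (ContinuousLinearMap.le_of_opNorm_le _ (hcβ y x) _)
  have hdiff := (abs_le.1 ((hhL _ _).trans (mul_le_mul_of_nonneg_left hnorm hL))).2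
  simp only [linearizedModel]
  linarith

open scoped RealInnerProductSpace

/-- First-order optimality of the prox-linear step. -/
theorem linearizedModel_le_add_inner_of_isProxLinear (hg : ConvexOn ℝ Set.univ g)
    (hh : ConvexOn ℝ Set.univ h) {x s : E}
    (hs : ∀ z, linearizedModel g h c x s + ‖s - x‖ ^ 2 / (2 * t) ≤
      linearizedModel g h c x z + ‖z - x‖ ^ 2 / (2 * t)) (z : E) :
    linearizedModel g h c x s ≤ linearizedModel g h c x z + ⟪t⁻¹ • (s - x), z - s⟫ := by
  refine (convexOn_linearizedModel hg hh x).le_add_inner_of_le_add_sq (K := t⁻¹ / 2) (fun z ↦ ?_) z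
  have hsq : ‖z - x‖ ^ 2 = ‖z - s‖ ^ 2 + 2 * ⟪s - x, z - s⟫ + ‖s - x‖ ^ 2 := by
    rw [← sub_add_sub_cancel z s x, norm_add_sq_real, real_inner_comm]
  have := hs z
  rw [hsq] at this
  rw [real_inner_smul_left]
  have e : ∀ a : ℝ, a / (2 * t) = t⁻¹ / 2 * a := fun a ↦ by rw [div_eq_mul_inv, mul_inv]; ring
  simp only [e] at this
  linarith

/-- First-order optimality of a proximal point of `g + h ∘ c`, in terms of the model based at it. -/
theorem linearizedModel_self_le_add_inner_of_isProx (hL : 0 ≤ L)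
    (hhL : ∀ u v, |h u - h v| ≤ L * ‖u - v‖) (hc : Differentiable ℝ c)
    (hcβ : ∀ x y, ‖fderiv ℝ c x - fderiv ℝ c y‖ ≤ β * ‖x - y‖) (hg : ConvexOn ℝ Set.univ g)
    (hh : ConvexOn ℝ Set.univ h) {k : ℝ} {x p : E}
    (hp : ∀ z, g p + h (c p) + k / 2 * ‖p - x‖ ^ 2 ≤ g z + h (c z) + k / 2 * ‖z - x‖ ^ 2) (z : E) :
    g p + h (c p) ≤ linearizedModel g h c p z + ⟪k • (p - x), z - p⟫ := by
  rw [← linearizedModel_self]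
  refine (convexOn_linearizedModel hg hh p).le_add_inner_of_le_add_sq (K := (k + L * β) / 2)
    (fun z ↦ ?_) z
  have hsq : ‖z - x‖ ^ 2 = ‖z - p‖ ^ 2 + 2 * ⟪p - x, z - p⟫ + ‖p - x‖ ^ 2 := by
    rw [← sub_add_sub_cancel z p x, norm_add_sq_real, real_inner_comm]
  have hm := (abs_le.1 (abs_sub_linearizedModel_le (g := g) hL hhL hc hcβ p z)).2
  have := hp z
  rw [hsq] at this
  rw [real_inner_smul_left, linearizedModel_self]
  linarith

/-- The prox-linear step is controlled by the displacement to the proximal point. -/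
theorem norm_sub_proxLinear_le (hL : 0 ≤ L) (hβ : 0 ≤ β) (ht : 0 < t)
    (hhL : ∀ u v, |h u - h v| ≤ L * ‖u - v‖) (hc : Differentiable ℝ c)
    (hcβ : ∀ x y, ‖fderiv ℝ c x - fderiv ℝ c y‖ ≤ β * ‖x - y‖) (hg : ConvexOn ℝ Set.univ g)
    (hh : ConvexOn ℝ Set.univ h) {x s p : E}
    (hs : ∀ z, linearizedModel g h c x s + ‖s - x‖ ^ 2 / (2 * t) ≤
      linearizedModel g h c x z + ‖z - x‖ ^ 2 / (2 * t))
    (hp : ∀ z, g p + h (c p) + (1 + t * (L * β)) / t / 2 * ‖p - x‖ ^ 2 ≤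
      g z + h (c z) + (1 + t * (L * β)) / t / 2 * ‖z - x‖ ^ 2) :
    ‖x - s‖ ≤ (1 + t * (L * β)) * (Real.sqrt (t * (L * β) / (1 + t * (L * β))) + 1) *
      ‖p - x‖ := by
  have hs' := linearizedModel_le_add_inner_of_isProxLinear hg hh hs p
  have hp' := linearizedModel_self_le_add_inner_of_isProx hL hhL hc hcβ hg hh hp s
  have hps := linearizedModel_le_add (g := g) hL hhL hc hcβ x p s
  have hxp := (abs_le.1 (abs_sub_linearizedModel_le (g := g) hL hhL hc hcβ x p)).1
  have htri : ‖x - s‖ ≤ ‖p - x‖ + ‖s - p‖ := by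
    rw [norm_sub_rev x s, add_comm]
    exact norm_sub_le_norm_sub_add_norm_sub s p x
  have hin₁ : 2 * ⟪s - x, p - s⟫ = ‖p - x‖ ^ 2 - ‖s - p‖ ^ 2 - ‖x - s‖ ^ 2 := by
    rw [← sub_add_sub_cancel p s x, norm_add_sq_real, real_inner_comm, norm_sub_rev s p,
      norm_sub_rev x s]
    ring
  have hin₂ : 2 * ⟪p - x, s - p⟫ = ‖x - s‖ ^ 2 - ‖s - p‖ ^ 2 - ‖p - x‖ ^ 2 := by
    rw [norm_sub_rev x s, ← sub_add_sub_cancel s p x, norm_add_sq_real, real_inner_comm]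
    ring
  rw [real_inner_smul_left] at hs' hp'
  have hμ : 0 ≤ L * β := mul_nonneg hL hβ
  generalize ⟪s - x, p - s⟫ = i₁ at *
  generalize ⟪p - x, s - p⟫ = i₂ at *
  have hr := norm_nonneg (x - s)
  have hd := norm_nonneg (p - x)
  have he := norm_nonneg (s - p)
  generalize ‖x - s‖ = r at *
  generalize ‖p - x‖ = d at *
  generalize ‖s - p‖ = e at *
  generalize L * β = μ at *
  have hsum : 0 ≤ t⁻¹ * i₁ + (1 + t * μ) / t * i₂ + μ * d ^ 2 + μ * (d * e) := by linarith
  have hsum' : 0 ≤ i₁ + (1 + t * μ) * i₂ + t * μ * d ^ 2 + t * μ * (d * e) := by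
    refine (mul_nonneg ht.le hsum).trans_eq ?_
    field_simp
  have ha : 0 ≤ t * μ := by positivity
  generalize t * μ = a at *
  have hr2 : r ^ 2 ≤ (d + e) ^ 2 := pow_le_pow_left₀ hr htri 2
  have hq : (e - a * d) ^ 2 ≤ (a ^ 2 + a) * d ^ 2 := by nlinarith [mul_le_mul_of_nonneg_left hr2 ha]
  have hσ : ((1 + a) * Real.sqrt (a / (1 + a))) ^ 2 = a ^ 2 + a := by
    rw [mul_pow, Real.sq_sqrt (by positivity)]
    field_simp
    ring
  have := abs_le_of_sq_le_sq (a := e - a * d) (b := (1 + a) * Real.sqrt (a / (1 + a)) * d)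
    (by rw [mul_pow, hσ]; exact hq) (by positivity)
  linarith [(abs_le.1 this).2]

/-- Existence of a proximal point of `g + h ∘ c` at `x`. -/
theorem exists_isProx [FiniteDimensional ℝ E] (hL : 0 ≤ L) (ht : 0 < t)
    (hhL : ∀ u v, |h u - h v| ≤ L * ‖u - v‖) (hc : Differentiable ℝ c)
    (hcβ : ∀ x y, ‖fderiv ℝ c x - fderiv ℝ c y‖ ≤ β * ‖x - y‖) (hg : ConvexOn ℝ Set.univ g)
    (hh : ConvexOn ℝ Set.univ h) {x s : E}
    (hs : ∀ z, linearizedModel g h c x s + ‖s - x‖ ^ 2 / (2 * t) ≤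
      linearizedModel g h c x z + ‖z - x‖ ^ 2 / (2 * t)) :
    ∃ p, ∀ z, g p + h (c p) + (1 + t * (L * β)) / t / 2 * ‖p - x‖ ^ 2 ≤
      g z + h (c z) + (1 + t * (L * β)) / t / 2 * ‖z - x‖ ^ 2 := by
  have hgcont : Continuous g := continuousOn_univ.1 (hg.continuousOn isOpen_univ)
  have hhcont : Continuous h := by
    refine (LipschitzWith.of_dist_le_mul (K := ⟨L, hL⟩) fun u v ↦ ?_).continuous
    simp only [dist_eq_norm, Real.norm_eq_abs]
    exact hhL u v
  have hccont := hc.continuous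
  refine Continuous.exists_forall_le_of_isBounded (by fun_prop) s ?_
  set Q := g s + h (c s) + (1 + t * (L * β)) / t / 2 * ‖s - x‖ ^ 2
  refine (Metric.isBounded_closedBall (x := s)
    (r := Real.sqrt (2 * t * (Q - linearizedModel g h c x s)))).subset fun z hz ↦ ?_
  rw [mem_closedBall_iff_norm]
  refine Real.le_sqrt_of_sq_le ?_
  have hopt := linearizedModel_le_add_inner_of_isProxLinear hg hh hs z
  have hm := (abs_le.1 (abs_sub_linearizedModel_le (g := g) hL hhL hc hcβ x z)).1
  have hsq : ‖z - x‖ ^ 2 = ‖z - s‖ ^ 2 + 2 * ⟪s - x, z - s⟫ + ‖s - x‖ ^ 2 := by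
    rw [← sub_add_sub_cancel z s x, norm_add_sq_real, real_inner_comm]
  rw [real_inner_smul_left] at hopt
  have hz : g z + h (c z) + (1 + t * (L * β)) / t / 2 * ‖z - x‖ ^ 2 ≤ Q := hz
  have hk : (1 + t * (L * β)) / t = t⁻¹ + L * β := by field_simp
  rw [hk] at hz
  have hle : t⁻¹ / 2 * ‖z - s‖ ^ 2 + t⁻¹ / 2 * ‖s - x‖ ^ 2 ≤ Q - linearizedModel g h c x s := by
    linear_combination hopt + hm + hz - t⁻¹ / 2 * hsq
  have hpos : 0 ≤ t⁻¹ / 2 * ‖s - x‖ ^ 2 := by positivity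
  calc ‖z - s‖ ^ 2 = 2 * t * (t⁻¹ / 2 * ‖z - s‖ ^ 2) := by field_simp
    _ ≤ _ := by gcongr; linarith

end LinearizedModel


/-- Prox-gradient versus the gradient of the Moreau envelope (second inequality of
Theorem 4.5): for the composite function `F = g + h ∘ c` with `μ = Lβ`, the prox-linear map
`S_t` and prox-gradient `G_t(x) = t⁻¹ (x - S_t x)` satisfy
`‖G_t(x)‖ ≤ ((1+2tμ)/(1+tμ))(√(tμ/(1+tμ)) + 1) ‖∇F_{t/(1+tμ)}(x)‖`. -/
theorem prox_gradient_le_envelope_gradient {d m : ℕ}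
    (g : EuclideanSpace ℝ (Fin d) → ℝ)
    (h : EuclideanSpace ℝ (Fin m) → ℝ)
    (c : EuclideanSpace ℝ (Fin d) → EuclideanSpace ℝ (Fin m))
    (L β t : ℝ) (hL : 0 ≤ L) (hβ : 0 ≤ β) (ht : 0 < t)
    (hg : ConvexOn ℝ Set.univ g) (hgc : LowerSemicontinuous g)
    (hh : ConvexOn ℝ Set.univ h)
    (hhL : ∀ u v, |h u - h v| ≤ L * ‖u - v‖)
    (hc : ContDiff ℝ 1 c)
    (hcβ : ∀ x y, ‖fderiv ℝ c x - fderiv ℝ c y‖ ≤ β * ‖x - y‖)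
    (S : EuclideanSpace ℝ (Fin d) → EuclideanSpace ℝ (Fin d))
    (hS : ∀ y z, g (S y) + h (c y + fderiv ℝ c y (S y - y)) + ‖S y - y‖ ^ 2 / (2 * t) ≤
        g z + h (c y + fderiv ℝ c y (z - y)) + ‖z - y‖ ^ 2 / (2 * t))
    (Fgrad : EuclideanSpace ℝ (Fin d) → EuclideanSpace ℝ (Fin d))
    (hgrad : ∀ w, HasGradientAt
        (fun w' => ⨅ z, (g z + h (c z) + ‖z - w'‖ ^ 2 / (2 * (t / (1 + t * (L * β))))))
        (Fgrad w) w)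
    (x : EuclideanSpace ℝ (Fin d)) :
    ‖t⁻¹ • (x - S x)‖ ≤ (1 + 2 * t * (L * β)) / (1 + t * (L * β)) *
      (Real.sqrt (t * (L * β) / (1 + t * (L * β))) + 1) * ‖Fgrad x‖ := by
  have hcd : Differentiable ℝ c := hc.differentiable one_ne_zero
  have hμ : 0 ≤ L * β := mul_nonneg hL hβ
  have hk : ∀ r : ℝ, r / (2 * (t / (1 + t * (L * β)))) = (1 + t * (L * β)) / t / 2 * r := fun r ↦ by
    field_simp
  simp only [hk] at hgrad
  obtain ⟨p, hp⟩ := exists_isProx hL ht hhL hcd hcβ hg hh (hS x)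
  have hbdd (w : EuclideanSpace ℝ (Fin d)) : BddBelow (Set.range fun z ↦
      g z + h (c z) + (1 + t * (L * β)) / t / 2 * ‖z - w‖ ^ 2) := by
    refine ⟨_, Set.forall_mem_range.2 fun z ↦ (hS w z).trans ?_⟩
    have hm := (abs_le.1 (abs_sub_linearizedModel_le (g := g) hL hhL hcd hcβ w z)).1
    have hsplit : (1 + t * (L * β)) / t / 2 * ‖z - w‖ ^ 2 =
        ‖z - w‖ ^ 2 / (2 * t) + L * β / 2 * ‖z - w‖ ^ 2 := by field_simp
    rw [linearizedModel] at hm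
    linarith
  have hv : Fgrad x = ((1 + t * (L * β)) / t) • (x - p) :=
    (hgrad x).eq_smul_sub_of_le_parabola (fun w ↦ ciInf_le (hbdd w) p)
      (le_antisymm (ciInf_le (hbdd x) p) (le_ciInf hp))
  have hmain := norm_sub_proxLinear_le hL hβ ht hhL hcd hcβ hg hh (hS x) hp
  rw [hv, norm_smul, norm_smul, Real.norm_of_nonneg (by positivity),
    Real.norm_of_nonneg (by positivity), norm_sub_rev x p]
  generalize L * β = μ at *
  calc t⁻¹ * ‖x - S x‖
      ≤ t⁻¹ * ((1 + t * μ) * (Real.sqrt (t * μ / (1 + t * μ)) + 1) * ‖p - x‖) := by gcongr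
    _ ≤ t⁻¹ * ((1 + 2 * t * μ) * (Real.sqrt (t * μ / (1 + t * μ)) + 1) * ‖p - x‖) := by
      gcongr
      linarith [mul_nonneg ht.le hμ]
    _ = _ := by field_simp
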